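/- arXiv:1709.07268 — 2 statements merged into one kernel-verified Lean document; each statement's English description precedes it below -/
import Mathlib

section
/- Let ρ, σ be density matrices such that ρ and σ commute after pinching, i.e., letting P_σ be the pinching map with respect to σ, one has D(P_σ(ρ)‖σ) ≥ D(ρ‖σ) - log|spec(σ)|, where |spec(σ)| is the number of distinct eigenvalues of σ. -/
noncomputable section
open scoped BigOperators ComplexOrder

variable {n : Type*} [Fintype n] [DecidableEq n]

/-- A density matrix: positive semidefinite with trace one. -/
def IsDensity (ρ : Matrix n n ℂ) : Prop := ρ.PosSemidef ∧ ρ.trace = 1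

/-- Apply a real function to a Hermitian matrix via the functional calculus
(junk value `0` if the matrix is not Hermitian). -/
noncomputable def matFun (A : Matrix n n ℂ) (f : ℝ → ℝ) : Matrix n n ℂ :=
  if h : A.IsHermitian then h.cfc f else 0

/-- Quantum relative entropy `D(ρ‖σ) = tr[ρ (log ρ - log σ)]`
(with `log` computed on the support, i.e. `Real.log 0 = 0` convention). -/
noncomputable def qRelEnt (ρ σ : Matrix n n ℂ) : ℝ :=
  ((ρ * (matFun ρ Real.log - matFun σ Real.log)).trace).re

/-- The set of distinct (real) eigenvalues of a matrix (junk `∅` if not Hermitian). -/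
noncomputable def specSet (A : Matrix n n ℂ) : Finset ℝ :=
  if h : A.IsHermitian then Finset.image h.eigenvalues Finset.univ else ∅

/-- The spectral projection of `A` onto the eigenspace of eigenvalue `lam`. -/
noncomputable def specProj (A : Matrix n n ℂ) (lam : ℝ) : Matrix n n ℂ :=
  matFun A (fun x => if x = lam then 1 else 0)

/-- The pinching map `P_σ(X) = ∑_{λ ∈ spec(σ)} P_λ X P_λ`. -/
noncomputable def pinch (σ X : Matrix n n ℂ) : Matrix n n ℂ :=
  ∑ lam ∈ specSet σ, specProj σ lam * X * specProj σ lam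

/-- Scalar core of the argument. -/
lemma scalar_core {ι : Type*} [Fintype ι] [DecidableEq ι] (p q : ι → ℝ) (W : Matrix ι ι ℂ)
    (k : ℝ) (hk : 0 < k) (hp : ∀ i, 0 ≤ p i) (hq : ∀ i, 0 ≤ q i) (hsum : ∑ i, p i = 1)
    (hW : ∀ i, ∑ j, ‖W i j‖ ^ 2 = 1)
    (H : ∀ y : ι → ℂ, ∑ i, p i * ‖(W.mulVec y) i‖ ^ 2 ≤ k * ∑ j, q j * ‖y j‖ ^ 2) :
    ∑ i, p i * Real.log (p i) - ∑ i, ∑ j, p i * ‖W i j‖ ^ 2 * Real.log (q j) ≤ Real.log k := by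
  have H1 : ∀ i (y : ι → ℂ), p i * ‖(W.mulVec y) i‖ ^ 2 ≤ k * ∑ j, q j * ‖y j‖ ^ 2 := by
    intro i y
    refine le_trans ?_ (H y)
    exact Finset.single_le_sum (f := fun i => p i * ‖(W.mulVec y) i‖ ^ 2)
      (fun i _ => mul_nonneg (hp i) (by positivity)) (Finset.mem_univ i)
  have H2 : ∀ i j, p i * ‖W i j‖ ^ 2 ≤ k * q j := by
    intro i j
    have := H1 i (Pi.single j 1)
    simpa [Pi.single_apply, apply_ite, ite_pow] using this
  have H3 : ∀ i, p i * ∑ j, ‖W i j‖ ^ 2 * (q j)⁻¹ ≤ k := by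
    intro i
    set a := ∑ j, ‖W i j‖ ^ 2 * (q j)⁻¹ with ha
    have ha0 : 0 ≤ a := Finset.sum_nonneg fun j _ => mul_nonneg (by positivity) (inv_nonneg.2 (hq j))
    have h := H1 i (fun j => ((q j)⁻¹ : ℝ) * star (W i j))
    have e1 : (W.mulVec (fun j => (((q j)⁻¹ : ℝ) : ℂ) * star (W i j))) i = (a : ℂ) := by
      simp only [Matrix.mulVec, dotProduct, ha]
      push_cast
      refine Finset.sum_congr rfl fun j _ => ?_
      have := Complex.mul_conj' (W i j)
      rw [← this]
      simp only [Complex.star_def]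
      ring
    have e2 : ∑ j, q j * ‖(((q j)⁻¹ : ℝ) : ℂ) * star (W i j)‖ ^ 2 = a := by
      rw [ha]
      refine Finset.sum_congr rfl fun j _ => ?_
      rw [norm_mul, norm_star, Complex.norm_real, mul_pow, Real.norm_eq_abs, sq_abs]
      by_cases h0 : q j = 0
      · simp [h0]
      · field_simp
    rw [e1, e2, Complex.norm_real, Real.norm_eq_abs, sq_abs] at h
    rcases ha0.eq_or_lt with h0 | h0
    · rw [← h0]; simpa using hk.le
    · have : (p i * a) * a ≤ k * a := by linarith [h]
      exact le_of_mul_le_mul_right this h0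
  have H4 : ∀ i, p i * Real.log (p i) - ∑ j, p i * ‖W i j‖ ^ 2 * Real.log (q j)
      ≤ p i * Real.log k := by
    intro i
    rcases (hp i).eq_or_lt with h0 | h0
    · simp [← h0]
    have key : ∀ j, ‖W i j‖ ^ 2 * (Real.log (p i) - Real.log (q j) - Real.log k)
        ≤ ‖W i j‖ ^ 2 * (p i * (q j)⁻¹ / k - 1) := by
      intro j
      rcases (hq j).eq_or_lt with h1 | h1
      · have := H2 i j
        rw [← h1] at this
        have h2 : ‖W i j‖ ^ 2 = 0 := by
          have : ‖W i j‖ ^ 2 ≤ 0 := by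
            by_contra hc
            push Not at hc
            have := mul_pos h0 hc
            linarith
          exact le_antisymm this (by positivity)
        simp [h2]
      · refine mul_le_mul_of_nonneg_left ?_ (by positivity)
        have h3 := Real.log_le_sub_one_of_pos (x := p i * (q j)⁻¹ / k) (by positivity)
        rw [Real.log_div (by positivity) hk.ne', Real.log_mul h0.ne' (by positivity),
          Real.log_inv] at h3
        linarith
    have s := Finset.sum_le_sum fun j (_ : j ∈ Finset.univ) => key j
    have l : ∑ j, ‖W i j‖ ^ 2 * (Real.log (p i) - Real.log (q j) - Real.log k)
        = Real.log (p i) - Real.log k - ∑ j, ‖W i j‖ ^ 2 * Real.log (q j) := by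
      have : ∀ j, ‖W i j‖ ^ 2 * (Real.log (p i) - Real.log (q j) - Real.log k)
        = ‖W i j‖ ^ 2 * (Real.log (p i) - Real.log k) - ‖W i j‖ ^ 2 * Real.log (q j) :=
        fun j => by ring
      simp_rw [this]
      rw [Finset.sum_sub_distrib, ← Finset.sum_mul, hW, one_mul]
    have r : ∑ j, ‖W i j‖ ^ 2 * (p i * (q j)⁻¹ / k - 1)
        = (p i * ∑ j, ‖W i j‖ ^ 2 * (q j)⁻¹) / k - 1 := by
      have : ∀ j, ‖W i j‖ ^ 2 * (p i * (q j)⁻¹ / k - 1)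
        = (p i / k) * (‖W i j‖ ^ 2 * (q j)⁻¹) - ‖W i j‖ ^ 2 :=
        fun j => by ring
      simp_rw [this]
      rw [Finset.sum_sub_distrib, ← Finset.mul_sum, hW]
      ring
    rw [l, r] at s
    have h5 : (p i * ∑ j, ‖W i j‖ ^ 2 * (q j)⁻¹) / k ≤ 1 := (div_le_one hk).2 (H3 i)
    have h6 : Real.log (p i) - ∑ j, ‖W i j‖ ^ 2 * Real.log (q j) ≤ Real.log k := by linarith
    have h7 := mul_le_mul_of_nonneg_left h6 h0.le
    rw [mul_sub, Finset.mul_sum] at h7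
    simpa [mul_assoc] using h7
  have s := Finset.sum_le_sum fun i (_ : i ∈ Finset.univ) => H4 i
  rw [Finset.sum_sub_distrib, ← Finset.sum_mul, hsum, one_mul] at s
  exact s

lemma matFun_eq {A : Matrix n n ℂ} (h : A.IsHermitian) (f : ℝ → ℝ) : matFun A f = cfc f A := by
  rw [matFun, dif_pos h, h.cfc_eq]

lemma matFun_eq_diag {A : Matrix n n ℂ} (h : A.IsHermitian) (f : ℝ → ℝ) :
    matFun A f = (h.eigenvectorUnitary : Matrix n n ℂ) *
      Matrix.diagonal (fun i => ((f (h.eigenvalues i) : ℝ) : ℂ)) *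
      (h.eigenvectorUnitary : Matrix n n ℂ).conjTranspose := by
  rw [matFun, dif_pos h, Matrix.IsHermitian.cfc, Unitary.conjStarAlgAut_apply]
  rfl

lemma matFun_id {A : Matrix n n ℂ} (h : A.IsHermitian) : matFun A (fun x => x) = A := by
  rw [matFun_eq h]
  exact cfc_id' ℝ A h.isSelfAdjoint

lemma trace_diag_formula (U V : Matrix n n ℂ) (p e : n → ℝ) :
    ((U * Matrix.diagonal (fun i => (p i : ℂ)) * U.conjTranspose) *
      (V * Matrix.diagonal (fun i => (e i : ℂ)) * V.conjTranspose)).trace.re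
      = ∑ i, ∑ j, p i * ‖(U.conjTranspose * V) i j‖ ^ 2 * e j := by
  set W := U.conjTranspose * V with hW
  have h1 : ((U * Matrix.diagonal (fun i => (p i : ℂ)) * U.conjTranspose) *
      (V * Matrix.diagonal (fun i => (e i : ℂ)) * V.conjTranspose)).trace
      = (Matrix.diagonal (fun i => (p i : ℂ)) * (W * Matrix.diagonal (fun i => (e i : ℂ)) *
        W.conjTranspose)).trace := by
    rw [hW, Matrix.conjTranspose_mul, Matrix.conjTranspose_conjTranspose]
    simp only [Matrix.mul_assoc]
    rw [Matrix.trace_mul_comm U]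
    simp only [Matrix.mul_assoc]
  rw [h1, Matrix.trace, Complex.re_sum]
  refine Finset.sum_congr rfl fun i _ => ?_
  rw [Matrix.diag_apply, Matrix.diagonal_mul, Matrix.mul_apply, Finset.mul_sum, Complex.re_sum]
  refine Finset.sum_congr rfl fun j _ => ?_
  rw [Matrix.mul_diagonal, Matrix.conjTranspose_apply]
  have : (p i : ℂ) * (W i j * (e j : ℂ) * star (W i j))
      = ((p i * ‖W i j‖ ^ 2 * e j : ℝ) : ℂ) := by
    push_cast
    rw [← Complex.mul_conj' (W i j)]
    simp only [Complex.star_def]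
    ring
  rw [this, Complex.ofReal_re]

lemma unitary_row (W : Matrix n n ℂ) (h : W * W.conjTranspose = 1) (i : n) :
    ∑ j, ‖W i j‖ ^ 2 = 1 := by
  have := congrFun (congrFun h i) i
  rw [Matrix.mul_apply, Matrix.one_apply_eq] at this
  have h2 : ((∑ j, ‖W i j‖ ^ 2 : ℝ) : ℂ) = 1 := by
    rw [← this]
    push_cast
    refine Finset.sum_congr rfl fun j _ => ?_
    rw [← Complex.mul_conj' (W i j)]
    rfl
  exact_mod_cast h2

lemma quad_diag (p : n → ℝ) (z : n → ℂ) :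
    (star z ⬝ᵥ (Matrix.diagonal (fun i => (p i : ℂ))).mulVec z) = ((∑ i, p i * ‖z i‖ ^ 2 : ℝ) : ℂ) := by
  simp only [dotProduct, Matrix.mulVec_diagonal]
  push_cast
  refine Finset.sum_congr rfl fun j _ => ?_
  rw [← Complex.mul_conj' (z j)]
  simp only [Pi.star_apply, Complex.star_def]
  ring

lemma entropy_le (ρ τ : Matrix n n ℂ) (hρ : ρ.PosSemidef) (htr : ρ.trace = 1)
    (hτ : τ.PosSemidef) (k : ℝ) (hk : 0 < k) (hle : ((k : ℂ) • τ - ρ).PosSemidef) :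
    (ρ * matFun ρ Real.log).trace.re - (ρ * matFun τ Real.log).trace.re ≤ Real.log k := by
  have hr := hρ.isHermitian
  have ht := hτ.isHermitian
  set U : Matrix n n ℂ := (hr.eigenvectorUnitary : Matrix n n ℂ) with hU
  set V : Matrix n n ℂ := (ht.eigenvectorUnitary : Matrix n n ℂ) with hV
  have hUU : U.conjTranspose * U = 1 := Unitary.coe_star_mul_self hr.eigenvectorUnitary
  have hUU' : U * U.conjTranspose = 1 := Unitary.coe_mul_star_self hr.eigenvectorUnitary
  have hVV : V.conjTranspose * V = 1 := Unitary.coe_star_mul_self ht.eigenvectorUnitary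
  have hVV' : V * V.conjTranspose = 1 := Unitary.coe_mul_star_self ht.eigenvectorUnitary
  have dρ := matFun_eq_diag hr (fun x => x)
  have dτ := matFun_eq_diag ht (fun x => x)
  rw [matFun_id hr] at dρ
  rw [matFun_id ht] at dτ
  have t1 : (ρ * matFun ρ Real.log).trace.re
      = ∑ i, hr.eigenvalues i * Real.log (hr.eigenvalues i) := by
    rw [matFun_eq_diag hr]
    conv_lhs => enter [1, 1, 1]; rw [dρ]
    rw [trace_diag_formula, hUU]
    refine Finset.sum_congr rfl fun i _ => ?_
    rw [Finset.sum_eq_single i]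
    · simp
    · intro j _ hj
      simp [Matrix.one_apply_ne hj.symm]
    · simp
  have t2 : (ρ * matFun τ Real.log).trace.re = ∑ i, ∑ j, hr.eigenvalues i *
      ‖(U.conjTranspose * V) i j‖ ^ 2 * Real.log (ht.eigenvalues j) := by
    rw [matFun_eq_diag ht]
    conv_lhs => enter [1, 1, 1]; rw [dρ]
    rw [trace_diag_formula]
  rw [t1, t2]
  refine scalar_core _ _ _ k hk hρ.eigenvalues_nonneg hτ.eigenvalues_nonneg ?_ ?_ ?_
  · have := hr.trace_eq_sum_eigenvalues
    rw [htr] at this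
    have h2 : ((∑ i, hr.eigenvalues i : ℝ) : ℂ) = 1 := by
      rw [this]
      push_cast
      rfl
    exact_mod_cast h2
  · apply unitary_row
    rw [Matrix.conjTranspose_mul, Matrix.conjTranspose_conjTranspose, Matrix.mul_assoc,
      ← Matrix.mul_assoc V, hVV', Matrix.one_mul, hUU]
  · intro y
    have h := hle.dotProduct_mulVec_nonneg (V.mulVec y)
    have e1 : star (V.mulVec y) ⬝ᵥ ρ.mulVec (V.mulVec y)
        = ((∑ i, hr.eigenvalues i * ‖((U.conjTranspose * V).mulVec y) i‖ ^ 2 : ℝ) : ℂ) := by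
      rw [← quad_diag]
      conv_lhs => rw [dρ]
      rw [Matrix.star_mulVec, Matrix.star_mulVec, Matrix.conjTranspose_mul,
        Matrix.conjTranspose_conjTranspose]
      simp only [Matrix.dotProduct_mulVec, Matrix.vecMul_vecMul, Matrix.mul_assoc, hU]
    have e2 : star (V.mulVec y) ⬝ᵥ τ.mulVec (V.mulVec y)
        = ((∑ i, ht.eigenvalues i * ‖y i‖ ^ 2 : ℝ) : ℂ) := by
      rw [← quad_diag]
      conv_lhs => rw [dτ]
      rw [Matrix.star_mulVec]
      simp only [Matrix.dotProduct_mulVec, Matrix.vecMul_vecMul]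
      rw [← hV, show V.conjTranspose * (V * (Matrix.diagonal fun i => (ht.eigenvalues i : ℂ)) *
        V.conjTranspose) * V = (V.conjTranspose * V) * (Matrix.diagonal fun i =>
          (ht.eigenvalues i : ℂ)) * (V.conjTranspose * V) by simp only [Matrix.mul_assoc], hVV]
      simp
    rw [Matrix.sub_mulVec, Matrix.smul_mulVec, dotProduct_sub, dotProduct_smul, e1, e2,
      smul_eq_mul, sub_nonneg] at h
    exact_mod_cast h

lemma cont_any (A : Matrix n n ℂ) (f : ℝ → ℝ) : ContinuousOn f (spectrum ℝ A) :=
  A.finite_real_spectrum.continuousOn f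

lemma specProj_mul {A : Matrix n n ℂ} (h : A.IsHermitian) (a b : ℝ) :
    specProj A a * specProj A b = if a = b then specProj A a else 0 := by
  simp only [specProj, matFun_eq h]
  rw [← cfc_mul _ _ A (cont_any _ _) (cont_any _ _)]
  split_ifs with hab
  · subst hab
    congr 1; ext x; simp
  · rw [← cfc_zero ℝ A]
    congr 1; ext x
    by_cases hx : x = a
    · subst hx; simp [hab]
    · simp [hx]

lemma specProj_herm {A : Matrix n n ℂ} (h : A.IsHermitian) (a : ℝ) :
    (specProj A a).conjTranspose = specProj A a := by
  simp only [specProj, matFun_eq h]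
  exact (cfc_predicate (R := ℝ) (p := IsSelfAdjoint) _ A : IsSelfAdjoint _)

lemma specProj_sum {A : Matrix n n ℂ} (h : A.IsHermitian) :
    ∑ a ∈ specSet A, specProj A a = 1 := by
  simp only [specProj, matFun_eq h]
  rw [← cfc_sum _ A _ (fun i _ => cont_any _ _), ← cfc_one ℝ A h.isSelfAdjoint]
  apply cfc_congr
  intro x hx
  rw [h.spectrum_real_eq_range_eigenvalues] at hx
  have : x ∈ specSet A := by
    rw [specSet, dif_pos h]; simpa using hx
  simp [Finset.sum_apply, this]

lemma pinch_trace {σ : Matrix n n ℂ} (h : σ.IsHermitian) (ρ X : Matrix n n ℂ)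
    (hX : ∀ a, Commute (specProj σ a) X) : (pinch σ ρ * X).trace = (ρ * X).trace := by
  rw [pinch, Finset.sum_mul, Matrix.trace_sum]
  have : ∀ a, (specProj σ a * ρ * specProj σ a * X).trace = (ρ * X * specProj σ a).trace := by
    intro a
    rw [Matrix.mul_assoc, Matrix.mul_assoc, Matrix.trace_mul_comm, (hX a).eq]
    simp only [Matrix.mul_assoc]
    rw [specProj_mul h, if_pos rfl]
  simp_rw [this]
  rw [← Matrix.trace_sum, ← Finset.mul_sum, specProj_sum h, Matrix.mul_one]

lemma pinch_comm {σ : Matrix n n ℂ} (h : σ.IsHermitian) (ρ : Matrix n n ℂ) (a : ℝ) :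
    Commute (pinch σ ρ) (specProj σ a) := by
  rw [pinch, commute_iff_eq, Finset.sum_mul, Finset.mul_sum]
  refine Finset.sum_congr rfl fun b _ => ?_
  rw [Matrix.mul_assoc _ (specProj σ b), specProj_mul h, ← Matrix.mul_assoc (specProj σ a),
    ← Matrix.mul_assoc (specProj σ a), specProj_mul h]
  by_cases hab : a = b
  · subst hab; simp
  · simp [hab, Ne.symm hab]

lemma pinch_psd {σ ρ : Matrix n n ℂ} (h : σ.IsHermitian) (hρ : ρ.PosSemidef) :
    (pinch σ ρ).PosSemidef := by
  rw [pinch]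
  refine Matrix.posSemidef_sum _ fun a _ => ?_
  have := hρ.conjTranspose_mul_mul_same (specProj σ a)
  rwa [specProj_herm h] at this

lemma pinch_ineq {σ ρ : Matrix n n ℂ} (h : σ.IsHermitian) (hρ : ρ.PosSemidef) :
    ((((specSet σ).card : ℝ) : ℂ) • pinch σ ρ - ρ).PosSemidef := by
  have e : (((specSet σ).card : ℝ) : ℂ) • pinch σ ρ - ρ = (2⁻¹ : ℂ) •
      ∑ a ∈ specSet σ, ∑ b ∈ specSet σ,
        ((specProj σ a - specProj σ b) * ρ * (specProj σ a - specProj σ b)) := by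
    have e1 : ∀ a b, (specProj σ a - specProj σ b) * ρ * (specProj σ a - specProj σ b)
        = specProj σ a * ρ * specProj σ a + specProj σ b * ρ * specProj σ b
          - specProj σ a * ρ * specProj σ b - specProj σ b * ρ * specProj σ a := by
      intro a b; noncomm_ring
    have s1 : ∑ a ∈ specSet σ, ∑ b ∈ specSet σ, specProj σ a * ρ * specProj σ b = ρ := by
      simp_rw [← Finset.mul_sum, specProj_sum h, Matrix.mul_one, ← Finset.sum_mul,
        specProj_sum h, Matrix.one_mul]
    have s2 : ∑ a ∈ specSet σ, ∑ b ∈ specSet σ, specProj σ b * ρ * specProj σ a = ρ := by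
      rw [Finset.sum_comm, s1]
    have s3 : ∑ a ∈ specSet σ, ∑ b ∈ specSet σ, specProj σ b * ρ * specProj σ b
        = (((specSet σ).card : ℝ) : ℂ) • pinch σ ρ := by
      rw [Finset.sum_const, ← pinch, Complex.ofReal_natCast, Nat.cast_smul_eq_nsmul]
    have s4 : ∑ a ∈ specSet σ, ∑ b ∈ specSet σ, specProj σ a * ρ * specProj σ a
        = (((specSet σ).card : ℝ) : ℂ) • pinch σ ρ := by
      rw [Finset.sum_comm, s3]
    simp_rw [e1, Finset.sum_sub_distrib, Finset.sum_add_distrib]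
    rw [s1, s2, s3, s4]
    module
  rw [e]
  refine Matrix.PosSemidef.smul ?_ (by norm_num [Complex.le_def])
  refine Matrix.posSemidef_sum _ fun a _ => Matrix.posSemidef_sum _ fun b _ => ?_
  have := hρ.conjTranspose_mul_mul_same (specProj σ a - specProj σ b)
  rwa [Matrix.conjTranspose_sub, specProj_herm h, specProj_herm h] at this

/-- Relative entropy after pinching: `D(P_σ(ρ)‖σ) ≥ D(ρ‖σ) - log |spec(σ)|`. -/
theorem pinching_relEnt {d : ℕ} (ρ σ : Matrix (Fin d) (Fin d) ℂ)
    (hρ : IsDensity ρ) (hσ : IsDensity σ)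
    (hsupp : ∀ v : Fin d → ℂ, σ.mulVec v = 0 → ρ.mulVec v = 0) :
    qRelEnt (pinch σ ρ) σ ≥ qRelEnt ρ σ - Real.log ((specSet σ).card) := by
  have hs := hσ.1.isHermitian
  have hτ := pinch_psd hs hρ.1
  have hcard : 0 < ((specSet σ).card : ℝ) := by
    have : (specSet σ).Nonempty := by
      rw [Finset.nonempty_iff_ne_empty]
      intro h0
      have h1 := specProj_sum hs
      rw [h0, Finset.sum_empty] at h1
      have h2 := hρ.2
      rw [← Matrix.mul_one ρ, ← h1] at h2
      simp at h2
    exact_mod_cast this.card_pos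
  have key := entropy_le ρ (pinch σ ρ) hρ.1 hρ.2 hτ _ hcard (pinch_ineq hs hρ.1)
  have c1 : (pinch σ ρ * matFun (pinch σ ρ) Real.log).trace
      = (ρ * matFun (pinch σ ρ) Real.log).trace := by
    refine pinch_trace hs _ _ fun a => ?_
    rw [matFun_eq hτ.isHermitian]
    exact ((pinch_comm hs ρ a).cfc_real _).symm
  have c2 : (pinch σ ρ * matFun σ Real.log).trace = (ρ * matFun σ Real.log).trace := by
    refine pinch_trace hs _ _ fun a => ?_
    rw [specProj, matFun_eq hs, matFun_eq hs]
    exact cfc_commute_cfc _ _ _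
  simp only [qRelEnt, Matrix.mul_sub, Matrix.trace_sub, Complex.sub_re, c1, c2]
  linarith
end
end

section
/- Let S be a set of density matrices on a d-dimensional Hilbert space, ω_n a density matrix on H^{⊗n}, and ν a measure on S. Then (1/n) D(∫ρ^{⊗n} dν(ρ) ‖ ω_n) ≥ inf_{ρ∈S} (1/n) D(ρ^{⊗n}‖ω_n) - (log p(n))/n for some polynomial p(n) depending only on d. -/
noncomputable section
open scoped BigOperators ComplexOrder
open MeasureTheory

variable {n : Type*} [Fintype n] [DecidableEq n]

/-- Measurable space structure on matrices (entrywise, via the pi structure). -/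
instance matrixMeasurableSpace {m k : Type*} : MeasurableSpace (Matrix m k ℂ) :=
  inferInstanceAs (MeasurableSpace (m → k → ℂ))

/-- `k`-fold tensor (Kronecker) power of a matrix. -/
noncomputable def tpow {d : ℕ} (ρ : Matrix (Fin d) (Fin d) ℂ) (k : ℕ) :
    Matrix (Fin k → Fin d) (Fin k → Fin d) ℂ :=
  Matrix.of fun x y => ∏ i, ρ (x i) (y i)

/-- The mixture `∫ ρ^{⊗k} dν(ρ)`, defined entrywise. -/
noncomputable def iidMixture {d : ℕ} (ν : Measure (Matrix (Fin d) (Fin d) ℂ)) (k : ℕ) :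
    Matrix (Fin k → Fin d) (Fin k → Fin d) ℂ :=
  Matrix.of fun x y => ∫ ρ, tpow ρ k x y ∂ν


open Matrix in
lemma spec_density {A : Matrix n n ℂ} (hA : IsDensity A) :
    ∃ (U : Matrix n n ℂ) (l : n → ℝ), Uᴴ * U = 1 ∧ U * Uᴴ = 1 ∧
      A = U * diagonal (fun i => (l i : ℂ)) * Uᴴ ∧
      (∀ f, matFun A f = U * diagonal (fun i => (f (l i) : ℂ)) * Uᴴ) ∧
      (∀ i, 0 ≤ l i) ∧ ∑ i, l i = 1 := by
  have hH : A.IsHermitian := hA.1.1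
  refine ⟨hH.eigenvectorUnitary, hH.eigenvalues, ?_, ?_, ?_, ?_, ?_, ?_⟩
  · exact Unitary.coe_star_mul_self hH.eigenvectorUnitary
  · exact Unitary.coe_mul_star_self hH.eigenvectorUnitary
  · have := hH.spectral_theorem
    rw [Unitary.conjStarAlgAut_apply] at this
    exact this
  · intro f
    rw [matFun, dif_pos hH, Matrix.IsHermitian.cfc, Unitary.conjStarAlgAut_apply]
    rfl
  · exact hA.1.eigenvalues_nonneg
  · have h1 := hH.trace_eq_sum_eigenvalues
    rw [hA.2] at h1
    simpa using congrArg Complex.re h1.symm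

open Matrix in
/-- trace of a product of two matrices given in spectral form -/
lemma trace_spec (U V : Matrix n n ℂ) (l m : n → ℝ) :
    ((V * diagonal (fun i => (l i : ℂ)) * Vᴴ) *
      (U * diagonal (fun i => (m i : ℂ)) * Uᴴ)).trace.re
      = ∑ j, ∑ b, l j * m b * ‖(Vᴴ * U) j b‖ ^ 2 := by
  have h1 : ((V * diagonal (fun i => (l i : ℂ)) * Vᴴ) *
      (U * diagonal (fun i => (m i : ℂ)) * Uᴴ)).trace
      = (diagonal (fun i => (l i : ℂ)) * ((Vᴴ * U) * diagonal (fun i => (m i : ℂ)) *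
          (Vᴴ * U)ᴴ)).trace := by
    rw [conjTranspose_mul, conjTranspose_conjTranspose, Matrix.mul_assoc V, Matrix.mul_assoc V,
      trace_mul_comm V]
    simp only [Matrix.mul_assoc]
  rw [h1]
  generalize Vᴴ * U = X
  simp only [trace, diag_apply, diagonal_mul, Complex.re_sum]
  refine Finset.sum_congr rfl fun j _ => ?_
  rw [Matrix.mul_apply, Finset.mul_sum, Complex.re_sum]
  refine Finset.sum_congr rfl fun b _ => ?_
  rw [mul_diagonal, conjTranspose_apply]
  have : (l j : ℂ) * (X j b * (m b : ℂ) * star (X j b))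
      = ((l j * m b * ‖X j b‖ ^ 2 : ℝ) : ℂ) := by
    have h2 := Complex.mul_conj' (X j b)
    push_cast
    rw [← h2, Complex.star_def]
    ring
  rw [this, Complex.ofReal_re]

open Matrix in
lemma row_norm {X : Matrix n n ℂ} (h : X * Xᴴ = 1) (j : n) : ∑ b, ‖X j b‖ ^ 2 = 1 := by
  have h1 := congrFun (congrFun h j) j
  rw [Matrix.mul_apply] at h1
  simp only [conjTranspose_apply, Complex.star_def, Complex.mul_conj', one_apply_eq] at h1
  exact_mod_cast h1

open Matrix in
/-- trace of `A f(A)` -/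
lemma trace_self_matFun {A U : Matrix n n ℂ} {l : n → ℝ} (hU : Uᴴ * U = 1)
    (hA : A = U * diagonal (fun i => (l i : ℂ)) * Uᴴ)
    (hf : ∀ f, matFun A f = U * diagonal (fun i => (f (l i) : ℂ)) * Uᴴ) (f : ℝ → ℝ) :
    (A * matFun A f).trace.re = ∑ i, l i * f (l i) := by
  rw [hf]
  conv_lhs => rw [hA]
  rw [trace_spec, hU]
  refine Finset.sum_congr rfl fun j _ => ?_
  rw [Finset.sum_eq_single j]
  · simp
  · intro b _ hb
    simp [hb.symm]
  · simp

/-- scalar core of the operator monotonicity estimate -/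
lemma scalar_core_s11 {X : Matrix n n ℂ} {l m : n → ℝ} {q : ℝ} (hq : 0 < q) (hX : ∀ j, ∑ b, ‖X j b‖ ^ 2 = 1)
    (hl : ∀ j, 0 ≤ l j) (hm : ∀ b, 0 ≤ m b)
    (H : ∀ y : n → ℂ, q * ∑ j, l j * ‖∑ b, X j b * y b‖ ^ 2 ≤ ∑ b, m b * ‖y b‖ ^ 2) (j : n)
    (hj : 0 < l j) : Real.log (q * l j) ≤ ∑ b, Real.log (m b) * ‖X j b‖ ^ 2 := by
  have Hj : ∀ y : n → ℂ, q * l j * ‖∑ b, X j b * y b‖ ^ 2 ≤ ∑ b, m b * ‖y b‖ ^ 2 := by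
    intro y
    refine le_trans ?_ (H y)
    rw [mul_assoc]
    refine mul_le_mul_of_nonneg_left ?_ hq.le
    exact Finset.single_le_sum (f := fun j => l j * ‖∑ b, X j b * y b‖ ^ 2)
      (fun i _ => mul_nonneg (hl i) (by positivity)) (Finset.mem_univ j)
  have hql : 0 < q * l j := mul_pos hq hj
  have hzero : ∀ b, m b = 0 → ‖X j b‖ = 0 := by
    intro b hb
    have h1 := Hj (Pi.single b 1)
    have h2 : ∑ c, m c * ‖(Pi.single b 1 : n → ℂ) c‖ ^ 2 = 0 := by
      refine Finset.sum_eq_zero fun c _ => ?_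
      by_cases hc : c = b
      · subst hc; simp [hb]
      · simp [hc]
    have h3 : ∑ c, X j c * (Pi.single b 1 : n → ℂ) c = X j b := by
      simp [Pi.single_apply]
    rw [h2, h3] at h1
    have : ‖X j b‖ ^ 2 ≤ 0 := by
      by_contra hc
      push Not at hc
      nlinarith [mul_pos hql hc]
    have := le_antisymm this (by positivity)
    exact pow_eq_zero_iff (two_ne_zero) |>.1 this
  set s : ℝ := ∑ b, ‖X j b‖ ^ 2 / m b with hs
  have hs0 : 0 ≤ s := Finset.sum_nonneg fun b _ => div_nonneg (by positivity) (hm b)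
  have hqs : q * l j * s ≤ 1 := by
    have h1 := Hj (fun b => star (X j b) / (m b : ℂ))
    have h2 : ∑ b, X j b * (star (X j b) / (m b : ℂ)) = (s : ℂ) := by
      rw [hs]; push_cast
      refine Finset.sum_congr rfl fun b _ => ?_
      rw [← Complex.mul_conj', Complex.star_def, mul_div_assoc]
    have h3 : ∑ b, m b * ‖star (X j b) / (m b : ℂ)‖ ^ 2 = s := by
      refine Finset.sum_congr rfl fun b _ => ?_
      rw [norm_div, norm_star, Complex.norm_real, Real.norm_of_nonneg (hm b)]
      by_cases hb : m b = 0
      · simp [hb]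
      · field_simp
    rw [h2, h3, Complex.norm_real, Real.norm_of_nonneg hs0] at h1
    by_contra hc
    push Not at hc
    have hspos : 0 < s := by
      by_contra h0
      have : s = 0 := le_antisymm (not_lt.1 h0) hs0
      rw [this] at hc; linarith [mul_zero (q * l j)]
    nlinarith [mul_pos hspos (sub_pos.2 hc)]
  have key : ∀ b, (Real.log (q * l j) + 1) * ‖X j b‖ ^ 2 - q * l j * (‖X j b‖ ^ 2 / m b)
      ≤ Real.log (m b) * ‖X j b‖ ^ 2 := by
    intro b
    by_cases hb : m b = 0
    · simp [hzero b hb]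
    · have hmb : 0 < m b := lt_of_le_of_ne (hm b) (Ne.symm hb)
      have h1 := Real.log_le_sub_one_of_pos (div_pos hql hmb)
      rw [Real.log_div hql.ne' hb] at h1
      have h2 : (Real.log (q * l j) + 1) - q * l j / m b ≤ Real.log (m b) := by linarith
      have h3 := mul_le_mul_of_nonneg_right h2 (sq_nonneg ‖X j b‖)
      refine le_trans (le_of_eq ?_) h3
      ring
  have := Finset.sum_le_sum fun b (_ : b ∈ Finset.univ) => key b
  rw [Finset.sum_sub_distrib, ← Finset.mul_sum, ← Finset.mul_sum, hX j, ← hs] at this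
  linarith

open Matrix in
lemma log_mono_trace {A B : Matrix n n ℂ} (hA : IsDensity A) (hB : IsDensity B) {q : ℝ}
    (hq : 0 < q) (hAB : (B - (q : ℂ) • A).PosSemidef) :
    (A * matFun A Real.log).trace.re + Real.log q ≤ (A * matFun B Real.log).trace.re := by
  obtain ⟨V, l, hV1, hV2, hAV, hfA, hl, hl1⟩ := spec_density hA
  obtain ⟨U, m, hU1, hU2, hBU, hfB, hm, hm1⟩ := spec_density hB
  rw [trace_self_matFun hV1 hAV hfA, hfB, hAV, trace_spec]
  set X := Vᴴ * U with hXdef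
  have hXX : X * Xᴴ = 1 := by
    rw [hXdef, conjTranspose_mul, conjTranspose_conjTranspose, Matrix.mul_assoc,
      ← Matrix.mul_assoc U, hU2, Matrix.one_mul, hV1]
  have hX := row_norm hXX
  have hquad : ∀ (Y : Matrix n n ℂ) (r : n → ℝ) (y : n → ℂ),
      star y ⬝ᵥ ((Yᴴ * diagonal (fun i => (r i : ℂ)) * Y) *ᵥ y)
        = ((∑ j, r j * ‖∑ b, Y j b * y b‖ ^ 2 : ℝ) : ℂ) := by
    intro Y r y
    rw [Matrix.mul_assoc, ← mulVec_mulVec, dotProduct_mulVec, ← star_mulVec, ← mulVec_mulVec]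
    simp only [dotProduct, mulVec_diagonal]
    push_cast
    refine Finset.sum_congr rfl fun j _ => ?_
    have : (Y *ᵥ y) j = ∑ b, Y j b * y b := rfl
    rw [← this, Pi.star_apply, ← Complex.conj_mul', Complex.star_def]
    ring
  have H : ∀ y : n → ℂ, q * ∑ j, l j * ‖∑ b, X j b * y b‖ ^ 2 ≤ ∑ b, m b * ‖y b‖ ^ 2 := by
    intro y
    have h1 := (hAB.conjTranspose_mul_mul_same U).dotProduct_mulVec_nonneg y
    have h2 : Uᴴ * (B - (q : ℂ) • A) * U =
        (1 : Matrix n n ℂ)ᴴ * diagonal (fun i => (m i : ℂ)) * 1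
          - (q : ℂ) • (Xᴴ * diagonal (fun i => (l i : ℂ)) * X) := by
      rw [Matrix.mul_sub, Matrix.sub_mul]
      congr 1
      · rw [hBU, conjTranspose_one, Matrix.one_mul, Matrix.mul_one]
        rw [Matrix.mul_assoc, Matrix.mul_assoc, hU1, Matrix.mul_one, ← Matrix.mul_assoc, hU1,
          Matrix.one_mul]
      · rw [hAV, hXdef, conjTranspose_mul, conjTranspose_conjTranspose, Matrix.mul_smul,
          Matrix.smul_mul]
        simp only [Matrix.mul_assoc]
    rw [h2, sub_mulVec, dotProduct_sub, smul_mulVec, dotProduct_smul, hquad, hquad, smul_eq_mul,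
      ← Complex.ofReal_mul, ← Complex.ofReal_sub, Complex.zero_le_real] at h1
    simp only [Matrix.one_apply, ite_mul, one_mul, zero_mul, Finset.sum_ite_eq,
      Finset.mem_univ, if_true] at h1
    linarith
  have h3 : ∀ j, l j * Real.log (l j) + l j * Real.log q
      ≤ ∑ b, l j * Real.log (m b) * ‖X j b‖ ^ 2 := by
    intro j
    rcases (hl j).eq_or_lt with h0 | hpos
    · simp [← h0]
    · have := mul_le_mul_of_nonneg_left (scalar_core_s11 hq hX hl hm H j hpos) (hl j)
      rw [Real.log_mul hq.ne' hpos.ne', Finset.mul_sum] at this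
      simp only [mul_assoc] at this ⊢
      linarith
  have h4 := Finset.sum_le_sum fun j (_ : j ∈ Finset.univ) => h3 j
  rw [Finset.sum_add_distrib, ← Finset.sum_mul, hl1, one_mul] at h4
  exact h4

lemma sum_log_ge {ι : Type*} [Fintype ι] (w : ι → ℝ) (hw : ∀ i, 0 < w i) (h1 : ∑ i, w i = 1) :
    - Real.log (Fintype.card ι) ≤ ∑ i, w i * Real.log (w i) := by
  have hne : Nonempty ι := by
    by_contra h
    rw [not_nonempty_iff] at h
    simp at h1
  have hN : (0 : ℝ) < Fintype.card ι := by exact_mod_cast Fintype.card_pos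
  have key : ∀ i, w i - 1 / (Fintype.card ι : ℝ)
      ≤ w i * Real.log (w i) + w i * Real.log (Fintype.card ι) := by
    intro i
    have hp : 0 < w i * Fintype.card ι := mul_pos (hw i) hN
    have h := Real.one_sub_inv_le_log_of_pos hp
    rw [Real.log_mul (hw i).ne' hN.ne'] at h
    have h2 := mul_le_mul_of_nonneg_left h (hw i).le
    have h3 : w i * (1 - (w i * (Fintype.card ι : ℝ))⁻¹) = w i - 1 / (Fintype.card ι : ℝ) := by
      have := (hw i).ne'
      field_simp
    linarith
  have h4 := Finset.sum_le_sum fun j (_ : j ∈ Finset.univ) => key j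
  rw [Finset.sum_sub_distrib, Finset.sum_add_distrib, ← Finset.sum_mul, h1] at h4
  simp only [Finset.sum_const, Finset.card_univ, nsmul_eq_mul] at h4
  rw [mul_one_div_cancel hN.ne'] at h4
  linarith

lemma isDensity_combo {ι : Type*} [Fintype ι] (w : ι → ℝ) (hw : ∀ i, 0 ≤ w i)
    (h1 : ∑ i, w i = 1) (T : ι → Matrix n n ℂ) (hT : ∀ i, IsDensity (T i)) :
    IsDensity (∑ i, (w i : ℂ) • T i) := by
  refine ⟨Matrix.posSemidef_sum _ fun i _ => (hT i).1.smul (by exact_mod_cast hw i), ?_⟩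
  simp only [Matrix.trace_sum, Matrix.trace_smul, (hT _).2, smul_eq_mul, mul_one]
  exact_mod_cast h1

/-- almost convexity of relative entropy -/
lemma qRelEnt_combo {ι : Type*} [Fintype ι] (w : ι → ℝ) (hw : ∀ i, 0 < w i)
    (h1 : ∑ i, w i = 1) (T : ι → Matrix n n ℂ) (hT : ∀ i, IsDensity (T i))
    (ω : Matrix n n ℂ) :
    ∑ i, w i * qRelEnt (T i) ω - Real.log (Fintype.card ι) ≤
      qRelEnt (∑ i, (w i : ℂ) • T i) ω := by
  classical
  set B := ∑ i, (w i : ℂ) • T i with hB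
  have hBd : IsDensity B := isDensity_combo w (fun i => (hw i).le) h1 T hT
  have hle : ∀ i, (B - (w i : ℂ) • T i).PosSemidef := by
    intro i
    have : B - (w i : ℂ) • T i = ∑ j ∈ Finset.univ.erase i, (w j : ℂ) • T j := by
      rw [hB, ← Finset.add_sum_erase _ _ (Finset.mem_univ i), add_sub_cancel_left]
    rw [this]
    exact Matrix.posSemidef_sum _ fun j _ => (hT j).1.smul (by exact_mod_cast (hw j).le)
  have hlin : qRelEnt B ω = ∑ i, w i * ((T i * (matFun B Real.log - matFun ω Real.log)).trace).re := by
    rw [qRelEnt]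
    generalize matFun B Real.log - matFun ω Real.log = M
    rw [hB, Finset.sum_mul, Matrix.trace_sum, Complex.re_sum]
    refine Finset.sum_congr rfl fun i _ => ?_
    rw [Matrix.smul_mul, Matrix.trace_smul, smul_eq_mul, Complex.re_ofReal_mul]
  have key : ∀ i, w i * qRelEnt (T i) ω + w i * Real.log (w i) ≤
      w i * ((T i * (matFun B Real.log - matFun ω Real.log)).trace).re := by
    intro i
    rw [← mul_add]
    refine mul_le_mul_of_nonneg_left ?_ (hw i).le
    have := log_mono_trace (hT i) hBd (hw i) (hle i)
    rw [qRelEnt]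
    simp only [Matrix.mul_sub, Matrix.trace_sub, Complex.sub_re]
    linarith
  have h4 := Finset.sum_le_sum fun j (_ : j ∈ Finset.univ) => key j
  rw [Finset.sum_add_distrib, ← hlin] at h4
  have := sum_log_ge w hw h1
  linarith

lemma matFun_polynomial {A : Matrix n n ℂ} (hA : A.IsHermitian) (P : Polynomial ℝ) :
    matFun A (fun x => P.eval x) = Polynomial.aeval A P := by
  rw [matFun, dif_pos hA, ← hA.cfc_eq]
  exact cfc_polynomial P A hA

open Matrix in
/-- the entropy is a uniform limit of polynomial trace functions -/
lemma entropy_approx (n : Type*) [Fintype n] [DecidableEq n] {ε : ℝ} (hε : 0 < ε) :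
    ∃ P : Polynomial ℝ, ∀ A : Matrix n n ℂ, IsDensity A →
      |(A * matFun A Real.log).trace.re - (Polynomial.aeval A P).trace.re| ≤ ε := by
  have hN : (0 : ℝ) < Fintype.card n + 1 := by positivity
  obtain ⟨P, hP⟩ := exists_polynomial_near_of_continuousOn 0 1 (fun x => x * Real.log x)
    Real.continuous_mul_log.continuousOn (ε / (Fintype.card n + 1)) (div_pos hε hN)
  refine ⟨P, fun A hA => ?_⟩
  obtain ⟨U, l, hU1, hU2, hAU, hf, hl, hl1⟩ := spec_density hA
  rw [trace_self_matFun hU1 hAU hf, ← matFun_polynomial hA.1.1, hf, trace_mul_comm,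
    ← Matrix.mul_assoc, hU1, Matrix.one_mul, trace_diagonal, Complex.re_sum]
  simp only [Complex.ofReal_re]
  rw [← Finset.sum_sub_distrib]
  refine (Finset.abs_sum_le_sum_abs _ _).trans ?_
  have : ∀ i ∈ Finset.univ, |l i * Real.log (l i) - P.eval (l i)| ≤ ε / (Fintype.card n + 1) := by
    intro i _
    have hi : l i ∈ Set.Icc (0 : ℝ) 1 := ⟨hl i, by
      rw [← hl1]; exact Finset.single_le_sum (fun j _ => hl j) (Finset.mem_univ i)⟩
    rw [abs_sub_comm]
    exact (hP _ hi).le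
  refine (Finset.sum_le_sum this).trans ?_
  rw [Finset.sum_const, Finset.card_univ, nsmul_eq_mul, mul_div_assoc', div_le_iff₀ hN]
  nlinarith

open Matrix in
lemma isClosed_isDensity : IsClosed {A : Matrix n n ℂ | IsDensity A} := by
  have : {A : Matrix n n ℂ | IsDensity A} =
      {A | Aᴴ = A} ∩ (⋂ x : n → ℂ, {A | 0 ≤ star x ⬝ᵥ (A *ᵥ x)}) ∩ {A | A.trace = 1} := by
    ext A
    simp only [IsDensity, posSemidef_iff_dotProduct_mulVec, Set.mem_setOf_eq, Set.mem_inter_iff,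
      Set.mem_iInter, Matrix.IsHermitian]
  rw [this]
  refine ((isClosed_eq (by fun_prop) continuous_id).inter
    (isClosed_iInter fun x => ?_)).inter (isClosed_eq (by fun_prop) continuous_const)
  exact isClosed_le continuous_const (by fun_prop)

open Matrix in
lemma density_entry_le {A : Matrix n n ℂ} (hA : IsDensity A) (a b : n) : ‖A a b‖ ≤ 1 := by
  obtain ⟨U, l, hU1, hU2, hAU, hf, hl, hl1⟩ := spec_density hA
  have hU : U ∈ Matrix.unitaryGroup n ℂ := ⟨hU1, hU2⟩
  rw [hAU, Matrix.mul_apply, ← hl1]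
  refine norm_sum_le_of_le _ fun j _ => ?_
  rw [mul_diagonal, conjTranspose_apply, norm_mul, norm_mul, norm_star, Complex.norm_real,
    Real.norm_of_nonneg (hl j)]
  have h1 := entry_norm_bound_of_unitary hU a j
  have h2 := entry_norm_bound_of_unitary hU b j
  have h3 := mul_le_one₀ h1 (norm_nonneg _) h2
  calc ‖U a j‖ * l j * ‖U b j‖ = (‖U a j‖ * ‖U b j‖) * l j := by ring
    _ ≤ 1 * l j := mul_le_mul_of_nonneg_right h3 (hl j)
    _ = l j := one_mul _

open Matrix in
/-- relative entropy (with the convention in force) is bounded below -/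
lemma qRelEnt_bddBelow (ω : Matrix n n ℂ) : ∃ c : ℝ, ∀ A, IsDensity A → c ≤ qRelEnt A ω := by
  refine ⟨-(Fintype.card n : ℝ) - ∑ x, ∑ y, ‖matFun ω Real.log y x‖, fun A hA => ?_⟩
  obtain ⟨U, l, hU1, hU2, hAU, hf, hl, hl1⟩ := spec_density hA
  have h1 : -(Fintype.card n : ℝ) ≤ (A * matFun A Real.log).trace.re := by
    rw [trace_self_matFun hU1 hAU hf]
    have : ∀ i ∈ Finset.univ, (-1 : ℝ) ≤ l i * Real.log (l i) := by
      intro i _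
      rcases (hl i).eq_or_lt with h0 | hpos
      · simp [← h0]
      · have h := mul_le_mul_of_nonneg_left (Real.one_sub_inv_le_log_of_pos hpos) hpos.le
        rw [mul_sub, mul_inv_cancel₀ hpos.ne'] at h
        linarith
    have := Finset.sum_le_sum this
    simpa using this
  have h2 : (A * matFun ω Real.log).trace.re ≤ ∑ x, ∑ y, ‖matFun ω Real.log y x‖ := by
    refine (Complex.re_le_norm _).trans ?_
    rw [trace]
    refine norm_sum_le_of_le _ fun x _ => ?_
    rw [diag_apply, Matrix.mul_apply]
    refine norm_sum_le_of_le _ fun y _ => ?_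
    rw [norm_mul]
    exact mul_le_of_le_one_left (norm_nonneg _) (density_entry_le hA x y)
  rw [qRelEnt, Matrix.mul_sub, trace_sub, Complex.sub_re]
  linarith

/-! ### tensor powers -/

lemma tpow_mul {d : ℕ} (A B : Matrix (Fin d) (Fin d) ℂ) (k : ℕ) :
    tpow (A * B) k = tpow A k * tpow B k := by
  ext x y
  simp only [tpow, Matrix.of_apply, Matrix.mul_apply]
  rw [Finset.prod_univ_sum]
  simp [Finset.prod_mul_distrib]

open Matrix in
lemma tpow_conjTranspose {d : ℕ} (A : Matrix (Fin d) (Fin d) ℂ) (k : ℕ) :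
    tpow (Aᴴ) k = (tpow A k)ᴴ := by
  ext x y
  simp [tpow, conjTranspose_apply]

lemma tpow_trace {d : ℕ} (A : Matrix (Fin d) (Fin d) ℂ) (k : ℕ) :
    (tpow A k).trace = A.trace ^ k := by
  simp only [Matrix.trace, Matrix.diag_apply, tpow, Matrix.of_apply]
  have := Finset.prod_univ_sum (fun _ : Fin k => (Finset.univ : Finset (Fin d)))
    (fun _ a => A a a)
  simpa using this.symm

open Matrix in
lemma exists_factor {A : Matrix n n ℂ} (hA : IsDensity A) : ∃ B : Matrix n n ℂ, A = B * Bᴴ := by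
  obtain ⟨U, l, hU1, hU2, hAU, hf, hl, hl1⟩ := spec_density hA
  refine ⟨U * diagonal (fun i => ((Real.sqrt (l i) : ℝ) : ℂ)), ?_⟩
  rw [conjTranspose_mul, diagonal_conjTranspose, hAU, Matrix.mul_assoc U (diagonal _) (_ * _),
    ← Matrix.mul_assoc (diagonal _) (diagonal _), diagonal_mul_diagonal, ← Matrix.mul_assoc]
  congr 3
  ext i
  rw [Pi.star_apply, Complex.star_def, Complex.conj_ofReal, ← Complex.ofReal_mul,
    Real.mul_self_sqrt (hl i)]

lemma tpow_density {d : ℕ} {A : Matrix (Fin d) (Fin d) ℂ} (hA : IsDensity A) (k : ℕ) :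
    IsDensity (tpow A k) := by
  obtain ⟨B, hB⟩ := exists_factor hA
  refine ⟨?_, by rw [tpow_trace, hA.2, one_pow]⟩
  rw [hB, tpow_mul, tpow_conjTranspose]
  exact Matrix.posSemidef_self_mul_conjTranspose _

/-- index set of joint types -/
abbrev TypeIdx (d k : ℕ) := Fin d × Fin d → Fin (k + 1)

/-- joint type of a pair of words -/
def jointType {d k : ℕ} (x y : Fin k → Fin d) : TypeIdx d k := fun ab =>
  ⟨(Finset.univ.filter fun i => (x i, y i) = ab).card, by
    have := Finset.card_le_univ (Finset.univ.filter fun i => (x i, y i) = ab)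
    rw [Fintype.card_fin] at this
    omega⟩

/-- symmetric matrix from its type coordinates -/
def symMat {d k : ℕ} (e : TypeIdx d k → ℂ) : Matrix (Fin k → Fin d) (Fin k → Fin d) ℂ :=
  Matrix.of fun x y => e (jointType x y)

/-- type coordinates of a tensor power -/
def typeCoord {d : ℕ} (k : ℕ) (ρ : Matrix (Fin d) (Fin d) ℂ) : TypeIdx d k → ℂ :=
  fun c => ∏ ab : Fin d × Fin d, ρ ab.1 ab.2 ^ (c ab : ℕ)

lemma symMat_typeCoord {d k : ℕ} (ρ : Matrix (Fin d) (Fin d) ℂ) :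
    symMat (typeCoord k ρ) = tpow ρ k := by
  ext x y
  simp only [symMat, typeCoord, tpow, Matrix.of_apply, jointType]
  rw [← Finset.prod_fiberwise Finset.univ (fun i => (x i, y i))]
  refine Finset.prod_congr rfl fun ab _ => ?_
  rw [← Finset.prod_const]
  refine Finset.prod_congr rfl fun i hi => ?_
  rw [Finset.mem_filter] at hi
  rw [← hi.2]

lemma symMat_sum {d k : ℕ} {ι : Type*} [Fintype ι] (w : ι → ℝ) (z : ι → TypeIdx d k → ℂ) :
    symMat (∑ i, w i • z i) = ∑ i, (w i : ℂ) • symMat (z i) := by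
  ext x y
  simp [symMat, Matrix.sum_apply, Finset.sum_apply]

lemma continuous_symMat {d k : ℕ} : Continuous (symMat : (TypeIdx d k → ℂ) → _) := by
  refine continuous_matrix fun x y => ?_
  exact continuous_apply _

lemma hull_bound {d k : ℕ} {S : Set (Matrix (Fin d) (Fin d) ℂ)} (hS : ∀ ρ ∈ S, IsDensity ρ)
    (ω : Matrix (Fin k → Fin d) (Fin k → Fin d) ℂ) {c : ℝ}
    (hc : ∀ ρ ∈ S, c ≤ qRelEnt (tpow ρ k) ω) {x : TypeIdx d k → ℂ}
    (hx : x ∈ convexHull ℝ (typeCoord k '' S)) :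
    IsDensity (symMat x) ∧
      c - Real.log (2 * ((k : ℝ) + 1) ^ (d * d) + 1) ≤ qRelEnt (symMat x) ω := by
  obtain ⟨ι, _, z, w, hz, hind, hw, hw1, rfl⟩ := eq_pos_convex_span_of_mem_convexHull hx
  have hzi : ∀ i, ∃ ρ ∈ S, symMat (z i) = tpow ρ k := by
    intro i
    obtain ⟨ρ, hρ, h⟩ := hz ⟨i, rfl⟩
    exact ⟨ρ, hρ, by rw [← h, symMat_typeCoord]⟩
  have hd : ∀ i, IsDensity (symMat (z i)) := by
    intro i
    obtain ⟨ρ, hρ, h⟩ := hzi i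
    rw [h]; exact tpow_density (hS ρ hρ) k
  rw [symMat_sum]
  refine ⟨isDensity_combo w (fun i => (hw i).le) hw1 _ hd, ?_⟩
  refine le_trans ?_ (qRelEnt_combo w hw hw1 _ hd ω)
  have h1 : c ≤ ∑ i, w i * qRelEnt (symMat (z i)) ω := by
    calc c = ∑ i, w i * c := by rw [← Finset.sum_mul, hw1, one_mul]
      _ ≤ _ := Finset.sum_le_sum fun i _ => by
        obtain ⟨ρ, hρ, h⟩ := hzi i
        rw [h]
        exact mul_le_mul_of_nonneg_left (hc ρ hρ) (hw i).le
  have hcard : Fintype.card ι ≤ 2 * (k + 1) ^ (d * d) + 1 := by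
    refine hind.card_le_finrank_succ.trans ?_
    refine Nat.add_le_add_right ?_ 1
    refine (Submodule.finrank_le _).trans (le_of_eq ?_)
    rw [Module.finrank_pi_fintype]
    simp [Complex.finrank_real_complex, mul_comm]
  have hpos : 0 < Fintype.card ι := by
    rw [Fintype.card_pos_iff]
    by_contra h
    rw [not_nonempty_iff] at h
    simp at hw1
  have h2 : Real.log (Fintype.card ι) ≤ Real.log (2 * ((k : ℝ) + 1) ^ (d * d) + 1) := by
    refine Real.log_le_log (by exact_mod_cast hpos) ?_
    exact_mod_cast hcard
  linarith

lemma closure_bound {d k : ℕ} {S : Set (Matrix (Fin d) (Fin d) ℂ)} (hS : ∀ ρ ∈ S, IsDensity ρ)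
    (ω : Matrix (Fin k → Fin d) (Fin k → Fin d) ℂ) {c : ℝ}
    (hc : ∀ ρ ∈ S, c ≤ qRelEnt (tpow ρ k) ω) {x : TypeIdx d k → ℂ}
    (hx : x ∈ closure (convexHull ℝ (typeCoord k '' S))) :
    c - Real.log (2 * ((k : ℝ) + 1) ^ (d * d) + 1) ≤ qRelEnt (symMat x) ω := by
  have hxd : IsDensity (symMat x) := by
    have hcl : IsClosed (symMat ⁻¹' {A : Matrix (Fin k → Fin d) (Fin k → Fin d) ℂ | IsDensity A}) :=
      isClosed_isDensity.preimage continuous_symMat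
    exact closure_minimal (fun y hy => (hull_bound hS ω hc hy).1) hcl hx
  refine le_of_forall_pos_le_add fun ε hε => ?_
  obtain ⟨P, hP⟩ := entropy_approx (Fin k → Fin d) (half_pos hε)
  have hsplit : ∀ A, qRelEnt A ω
      = (A * matFun A Real.log).trace.re - (A * matFun ω Real.log).trace.re := by
    intro A
    rw [qRelEnt, Matrix.mul_sub, Matrix.trace_sub, Complex.sub_re]
  have hcont : Continuous fun y : TypeIdx d k → ℂ => (Polynomial.aeval (symMat y) P).trace.re
      - (symMat y * matFun ω Real.log).trace.re := by
    have h0 := continuous_symMat (d := d) (k := k)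
    refine Continuous.sub ?_ ?_
    · exact Complex.continuous_re.comp ((P.continuous_aeval.comp h0).matrix_trace)
    · exact Complex.continuous_re.comp ((h0.matrix_mul continuous_const).matrix_trace)
  have hcl := isClosed_le (continuous_const (y := c
    - Real.log (2 * ((k : ℝ) + 1) ^ (d * d) + 1) - ε / 2)) hcont
  have hmem := closure_minimal (s := convexHull ℝ (typeCoord k '' S)) (fun y hy => ?_) hcl hx
  · have h1 := abs_le.1 (hP _ hxd)
    rw [hsplit]
    simp only [Set.mem_setOf_eq] at hmem
    linarith [h1.1]
  · obtain ⟨hyd, hy⟩ := hull_bound hS ω hc hy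
    have h1 := abs_le.1 (hP _ hyd)
    rw [hsplit] at hy
    simp only [Set.mem_setOf_eq]
    linarith [h1.2]

lemma measurable_typeCoord {d k : ℕ} :
    Measurable (typeCoord k : Matrix (Fin d) (Fin d) ℂ → _) := by
  have hentry : ∀ a b, Measurable fun ρ : Matrix (Fin d) (Fin d) ℂ => ρ a b := by
    intro a b
    exact (measurable_pi_apply b).comp
      (measurable_pi_apply (X := fun _ : Fin d => Fin d → ℂ) a)
  refine measurable_pi_lambda _ fun c => ?_
  exact Finset.measurable_prod _ fun ab _ => (hentry ab.1 ab.2).pow_const _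

lemma mixture_bound {d k : ℕ} {S : Set (Matrix (Fin d) (Fin d) ℂ)} (hS : ∀ ρ ∈ S, IsDensity ρ)
    (ν : Measure (Matrix (Fin d) (Fin d) ℂ)) [IsProbabilityMeasure ν] (hν : ν Sᶜ = 0)
    (ω : Matrix (Fin k → Fin d) (Fin k → Fin d) ℂ) {c : ℝ}
    (hc : ∀ ρ ∈ S, c ≤ qRelEnt (tpow ρ k) ω) :
    c - Real.log (2 * ((k : ℝ) + 1) ^ (d * d) + 1) ≤ qRelEnt (iidMixture ν k) ω := by
  have hae : ∀ᵐ ρ ∂ν, ρ ∈ S := by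
    rw [ae_iff]; exact hν
  have hint : Integrable (typeCoord k : Matrix (Fin d) (Fin d) ℂ → _) ν := by
    refine Integrable.of_bound measurable_typeCoord.aestronglyMeasurable 1 ?_
    filter_upwards [hae] with ρ hρ
    rw [pi_norm_le_iff_of_nonneg zero_le_one]
    intro c
    rw [typeCoord, norm_prod]
    refine Finset.prod_le_one (fun _ _ => norm_nonneg _) fun ab _ => ?_
    rw [norm_pow]
    exact pow_le_one₀ (norm_nonneg _) (density_entry_le (hS ρ hρ) _ _)
  have hmem : (∫ ρ, typeCoord k ρ ∂ν) ∈ closure (convexHull ℝ (typeCoord k '' S)) := by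
    refine (convex_convexHull ℝ _).closure.integral_mem isClosed_closure ?_ hint
    filter_upwards [hae] with ρ hρ
    exact subset_closure (subset_convexHull ℝ _ ⟨ρ, hρ, rfl⟩)
  have heq : iidMixture ν k = symMat (∫ ρ, typeCoord k ρ ∂ν) := by
    ext x y
    simp only [iidMixture, symMat, Matrix.of_apply]
    rw [eval_integral (fun i => Integrable.eval hint i)]
    refine integral_congr_ae (Filter.Eventually.of_forall fun ρ => ?_)
    simp only [← symMat_typeCoord]
    rfl
  rw [heq]
  exact closure_bound hS ω hc hmem

/-- Replacing a mixture of iid states by the worst iid state costs at most `log p(k) / k`: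
there is a polynomial `p` (depending only on `d`) such that
`(1/k) D(∫ρ^{⊗k}dν‖ωₖ) ≥ inf_{ρ∈S} (1/k) D(ρ^{⊗k}‖ωₖ) - (log p(k))/k`. -/
theorem mixture_relEnt_ge_inf_iid (d : ℕ) :
    ∃ p : Polynomial ℝ,
      ∀ (k : ℕ) (S : Set (Matrix (Fin d) (Fin d) ℂ)), (∀ ρ ∈ S, IsDensity ρ) →
        ∀ (ν : Measure (Matrix (Fin d) (Fin d) ℂ)), IsProbabilityMeasure ν → ν Sᶜ = 0 →
          ∀ ωk : Matrix (Fin k → Fin d) (Fin k → Fin d) ℂ, IsDensity ωk →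
            (1 / (k : ℝ)) * qRelEnt (iidMixture ν k) ωk ≥
              (⨅ ρ : S, (1 / (k : ℝ)) * qRelEnt (tpow ρ.1 k) ωk) -
                Real.log (p.eval (k : ℝ)) / (k : ℝ) := by
  refine ⟨2 * (Polynomial.X + 1) ^ (d * d) + 1, fun k S hS ν hνp hν ω hω => ?_⟩
  have heval : (2 * (Polynomial.X + 1) ^ (d * d) + 1 : Polynomial ℝ).eval (k : ℝ)
      = 2 * ((k : ℝ) + 1) ^ (d * d) + 1 := by
    simp
  rw [heval]
  rcases Nat.eq_zero_or_pos k with hk | hk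
  · subst hk
    simp
  have hkpos : (0 : ℝ) < k := by exact_mod_cast hk
  set m : ℝ := ⨅ ρ : S, (1 / (k : ℝ)) * qRelEnt (tpow ρ.1 k) ω with hm
  have hbdd : BddBelow (Set.range fun ρ : S => (1 / (k : ℝ)) * qRelEnt (tpow ρ.1 k) ω) := by
    obtain ⟨c, hc⟩ := qRelEnt_bddBelow ω
    refine ⟨(1 / (k : ℝ)) * c, ?_⟩
    rintro _ ⟨ρ, rfl⟩
    exact mul_le_mul_of_nonneg_left (hc _ (tpow_density (hS ρ.1 ρ.2) k)) (by positivity)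
  have hc : ∀ ρ ∈ S, k * m ≤ qRelEnt (tpow ρ k) ω := by
    intro ρ hρ
    have h1 : m ≤ (1 / (k : ℝ)) * qRelEnt (tpow ρ k) ω := ciInf_le hbdd ⟨ρ, hρ⟩
    have h2 := mul_le_mul_of_nonneg_left h1 hkpos.le
    rwa [← mul_assoc, mul_one_div_cancel hkpos.ne', one_mul] at h2
  have h := mixture_bound hS ν hν ω hc
  have h2 := mul_le_mul_of_nonneg_left h (one_div_nonneg.2 hkpos.le)
  refine le_trans (le_of_eq ?_) h2
  field_simp
end
end
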